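/- arXiv:1204.3812 — 2 statements merged into one kernel-verified Lean document; each statement's English description precedes it below -/
import Mathlib

section
/- For every s ≥ 0, the double integral ∫₀^∞ ∫₀^∞ (1 − e^{−s·P·h·G(t)}) q(h) p(t) dh dt is finite. -/
open MeasureTheory ProbabilityTheory Filter
open scoped Topology ENNReal

/-- The product of a locally integrable density with a bounded path-loss function is integrable on
`(0, ∞)` as soon as the product of their power-law tail bounds is. -/
lemma integrableOn_pathLoss_mul_density {α ε : ℝ} (hε : 0 < ε) {G p : ℝ → ℝ}
    (hG_meas : Measurable G) (hG_nonneg : ∀ t, 0 ≤ t → 0 ≤ G t)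
    (hG_bdd : ∃ C : ℝ, ∀ t, 0 ≤ t → G t ≤ C)
    (hG_tail : ∃ K > (0:ℝ), ∃ B > (0:ℝ), ∀ t ≥ B, G t ≤ K * t ^ (-α))
    (hp_meas : Measurable p) (hp_nonneg : ∀ t, 0 ≤ p t)
    (hp_loc : ∀ b : ℝ, IntegrableOn p (Set.Icc 0 b))
    (hp_bigO : ∃ C > (0:ℝ), ∃ B' > (0:ℝ), ∀ t ≥ B', p t ≤ C * t ^ (α - 1 - ε)) :
    IntegrableOn (fun t => G t * p t) (Set.Ioi 0) := by
  obtain ⟨C, hC⟩ := hG_bdd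
  obtain ⟨K, hK, B, hB, hGB⟩ := hG_tail
  obtain ⟨D, hD, B', hB', hpB⟩ := hp_bigO
  have hM : 0 < max B B' := lt_max_of_lt_left hB
  have hmeas : Measurable fun t => G t * p t := hG_meas.mul hp_meas
  have hnear : IntegrableOn (fun t => G t * p t) (Set.Icc 0 (max B B')) := by
    refine ((hp_loc (max B B')).const_mul C).mono' hmeas.aestronglyMeasurable ?_
    refine (ae_restrict_iff' measurableSet_Icc).2 (ae_of_all _ fun t ht => ?_)
    rw [Real.norm_of_nonneg (mul_nonneg (hG_nonneg t ht.1) (hp_nonneg t))]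
    exact mul_le_mul_of_nonneg_right (hC t ht.1) (hp_nonneg t)
  have hfar : IntegrableOn (fun t => G t * p t) (Set.Ioi (max B B')) := by
    refine ((integrableOn_Ioi_rpow_of_lt (by linarith : -1 - ε < -1) hM).const_mul
      (K * D)).mono' hmeas.aestronglyMeasurable ?_
    refine (ae_restrict_iff' measurableSet_Ioi).2 (ae_of_all _ fun t ht => ?_)
    have ht : max B B' < t := ht
    have ht0 : 0 < t := hM.trans ht
    rw [Real.norm_of_nonneg (mul_nonneg (hG_nonneg t ht0.le) (hp_nonneg t))]
    calc G t * p t ≤ (K * t ^ (-α)) * (D * t ^ (α - 1 - ε)) :=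
          mul_le_mul (hGB t ((le_max_left _ _).trans ht.le))
            (hpB t ((le_max_right _ _).trans ht.le)) (hp_nonneg t) (by positivity)
      _ = K * D * (t ^ (-α) * t ^ (α - 1 - ε)) := by ring
      _ = K * D * t ^ (-1 - ε) := by
          rw [← Real.rpow_add ht0]
          congr 2
          ring
  refine (hnear.union hfar).mono_set fun t ht => ?_
  rcases le_or_gt t (max B B') with h | h
  · exact Or.inl ⟨le_of_lt ht, h⟩
  · exact Or.inr h

theorem laplace_exponent_finite
    {α ε lam P : ℝ} (hα : 2 < α) (hε : 0 < ε) (hlam : 0 < lam) (hP : 0 < P)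
    (G p q : ℝ → ℝ)
    (hG_meas : Measurable G)
    (hG_nonneg : ∀ t, 0 ≤ t → 0 ≤ G t)
    (hG_bdd : ∃ C : ℝ, ∀ t, 0 ≤ t → G t ≤ C)
    (hG_anti : AntitoneOn G (Set.Ici 0))
    (hG_tail : ∃ K > (0:ℝ), ∃ B > (0:ℝ), ∀ t ≥ B, G t ≤ K * t ^ (-α))
    (hp_meas : Measurable p) (hp_nonneg : ∀ t, 0 ≤ p t)
    (hp_loc : ∀ b : ℝ, IntegrableOn p (Set.Icc 0 b))
    (hp_top : ∫⁻ t in Set.Ioi (0:ℝ), ENNReal.ofReal (p t) = ⊤)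
    (hp_bigO : ∃ C > (0:ℝ), ∃ B' > (0:ℝ), ∀ t ≥ B', p t ≤ C * t ^ (α - 1 - ε))
    (hq_meas : Measurable q) (hq_nonneg : ∀ h, 0 ≤ q h)
    (hq_prob : ∫ h in Set.Ioi (0:ℝ), q h = 1)
    (hq_m1 : IntegrableOn (fun h => h * q h) (Set.Ioi 0))
    (hq_m2 : IntegrableOn (fun h => h ^ 2 * q h) (Set.Ioi 0))
    (hq_m3 : IntegrableOn (fun h => h ^ 3 * q h) (Set.Ioi 0))
    :
    ∀ s : ℝ, 0 ≤ s →
      (∫⁻ t in Set.Ioi (0:ℝ), ∫⁻ h in Set.Ioi (0:ℝ),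
        ENNReal.ofReal ((1 - Real.exp (-(s * P * h * G t))) * q h * p t)) < ⊤ := by
  intro s hs
  have hGp : IntegrableOn (fun t => G t * p t) (Set.Ioi 0) :=
    integrableOn_pathLoss_mul_density hε hG_meas hG_nonneg hG_bdd hG_tail hp_meas hp_nonneg
      hp_loc hp_bigO
  have hbound : ∀ t ∈ Set.Ioi (0:ℝ), ∀ h ∈ Set.Ioi (0:ℝ),
      ENNReal.ofReal ((1 - Real.exp (-(s * P * h * G t))) * q h * p t) ≤
        ENNReal.ofReal (s * P * (G t * p t)) * ENNReal.ofReal (h * q h) := by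
    intro t ht h hh
    have hGt : 0 ≤ G t := hG_nonneg t (le_of_lt ht)
    have hexp : 1 - Real.exp (-(s * P * h * G t)) ≤ s * P * h * G t := by
      linarith [Real.add_one_le_exp (-(s * P * h * G t))]
    rw [← ENNReal.ofReal_mul (mul_nonneg (mul_nonneg hs hP.le) (mul_nonneg hGt (hp_nonneg t)))]
    refine ENNReal.ofReal_le_ofReal ?_
    calc (1 - Real.exp (-(s * P * h * G t))) * q h * p t
        ≤ s * P * h * G t * q h * p t := by
          have hqh := hq_nonneg h
          have hpt := hp_nonneg t
          gcongr
      _ = s * P * (G t * p t) * (h * q h) := by ring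
  calc (∫⁻ t in Set.Ioi (0:ℝ), ∫⁻ h in Set.Ioi (0:ℝ),
        ENNReal.ofReal ((1 - Real.exp (-(s * P * h * G t))) * q h * p t))
      ≤ ∫⁻ t in Set.Ioi (0:ℝ), ∫⁻ h in Set.Ioi (0:ℝ),
          ENNReal.ofReal (s * P * (G t * p t)) * ENNReal.ofReal (h * q h) :=
        setLIntegral_mono' measurableSet_Ioi fun t ht =>
          setLIntegral_mono' measurableSet_Ioi (hbound t ht)
    _ = (∫⁻ t in Set.Ioi (0:ℝ), ENNReal.ofReal (s * P * (G t * p t))) *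
          ∫⁻ h in Set.Ioi (0:ℝ), ENNReal.ofReal (h * q h) := by
        simp_rw [lintegral_const_mul' _ _ ENNReal.ofReal_ne_top]
        exact lintegral_mul_const _ (by fun_prop)
    _ < ⊤ := ENNReal.mul_lt_top (hGp.const_mul (s * P)).lintegral_lt_top hq_m1.lintegral_lt_top
end

section
/- The outage capacity is lower bounded as C_outage(γ) ≥ sup{R > 0 : 1 − E[max(0, Q⁻(ζ(H̃, R))) · 1{H̃ ≥ SNR^{−1}(e^R − 1)/G(d)}] ≤ γ}, where Q⁻(x) = Φ(x) − c(x)/√λ. -/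
open MeasureTheory ProbabilityTheory Filter
open scoped Topology ENNReal

/-- For independent `X` and `Y`, the probability that `(X, Y)` lies in `s` is the mean over `Y` of
the probability of the corresponding slice of `s`. -/
theorem ProbabilityTheory.IndepFun.measureReal_preimage_prod_eq_integral {Ω α β : Type*} [MeasurableSpace Ω]
    [MeasurableSpace α] [MeasurableSpace β] {μ : Measure Ω} [IsProbabilityMeasure μ]
    {X : Ω → α} {Y : Ω → β} (hX : Measurable X) (hY : Measurable Y) (hXY : IndepFun X Y μ)
    {s : Set (β × α)} (hs : MeasurableSet s) :
    Integrable (fun ω => μ.real {ω' | (Y ω, X ω') ∈ s}) μ ∧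
      ∫ ω, μ.real {ω' | (Y ω, X ω') ∈ s} ∂μ = μ.real {ω | (Y ω, X ω) ∈ s} := by
  have := Measure.isProbabilityMeasure_map (μ := μ) hX.aemeasurable
  have hslice (ω : Ω) : μ {ω' | (Y ω, X ω') ∈ s} = μ.map X (Prod.mk (Y ω) ⁻¹' s) :=
    (Measure.map_apply hX (measurable_prodMk_left hs)).symm
  have hmeas : Measurable fun ω => μ {ω' | (Y ω, X ω') ∈ s} := by
    simp_rw [hslice]
    exact (measurable_measure_prodMk_left hs).comp hY
  refine ⟨Integrable.of_bound hmeas.ennreal_toReal.aestronglyMeasurable 1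
    (ae_of_all _ fun ω => ?_), ?_⟩
  · rw [Real.norm_of_nonneg measureReal_nonneg]
    exact measureReal_le_one
  · simp only [measureReal_def]
    rw [integral_toReal hmeas.aemeasurable (ae_of_all _ fun ω => measure_lt_top μ _)]
    congr 1
    simp_rw [hslice]
    rw [← lintegral_map (measurable_measure_prodMk_left hs) hY, ← Measure.prod_apply hs,
      ← (indepFun_iff_map_prod_eq_prod_map_map hY.aemeasurable hX.aemeasurable).1 hXY.symm,
      Measure.map_apply (hY.prodMk hX) hs]
    rfl

/-- The levels `r` at which the lower tail of a random variable has probability at most `p < 1`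
are bounded above. -/
theorem bddAbove_setOf_measureReal_lt_le {Ω : Type*} [MeasurableSpace Ω] (μ : Measure Ω)
    [IsProbabilityMeasure μ] (X : Ω → ℝ) {p : ℝ} (hp : p < 1) :
    BddAbove {r : ℝ | μ.real {ω | X ω < r} ≤ p} := by
  have hmono : Monotone fun n : ℕ => {ω | X ω < n} := fun m n hmn ω hω =>
    lt_of_lt_of_le (Set.mem_ofPred.1 hω) (Nat.cast_le.2 hmn)
  have htend := tendsto_measure_iUnion_atTop (μ := μ) hmono
  have hunion : ⋃ n : ℕ, {ω | X ω < n} = Set.univ :=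
    Set.eq_univ_of_forall fun ω => Set.mem_iUnion.2 (exists_nat_gt (X ω))
  rw [hunion, measure_univ] at htend
  have hreal := (ENNReal.tendsto_toReal ENNReal.one_ne_top).comp htend
  obtain ⟨n, hn⟩ := (hreal.eventually (lt_mem_nhds (by simpa using hp))).exists
  refine ⟨n, fun r hr => le_of_not_gt fun hnr => ?_⟩
  have hle : μ.real {ω | X ω < n} ≤ μ.real {ω | X ω < r} :=
    measureReal_mono fun ω hω => lt_trans hω hnr
  exact absurd (hle.trans hr) (not_le.2 hn)

/-- The rate `log (1 + h g / (a + x / b))` reaches `R` iff the interference `x` does not exceed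
the threshold solving for equality. -/
theorem le_log_one_add_div_iff {a b g h x R : ℝ} (ha : 0 < a) (hb : 0 < b) (hg : 0 ≤ g)
    (hh : 0 ≤ h) (hx : 0 ≤ x) (hR : 0 < R) :
    R ≤ Real.log (1 + h * g / (a + x / b)) ↔ x ≤ (h * g / (Real.exp R - 1) - a) * b := by
  have he : 0 < Real.exp R - 1 := by linarith [Real.add_one_lt_exp hR.ne']
  have hden : 0 < a + x / b := by positivity
  rw [Real.le_log_iff_exp_le (by positivity), ← sub_le_iff_le_add', le_div_iff₀ hden,
    ← div_le_iff₀ hb, le_sub_iff_add_le', le_div_iff₀ he, mul_comm]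

theorem outage_capacity_lower_bound
    {Ω : Type*} [MeasurableSpace Ω] (μ : Measure Ω) [IsProbabilityMeasure μ]
    (lam SNR PG d : ℝ) (hlam : 0 < lam) (hSNR : 0 < SNR) (hPG : 1 ≤ PG) (hd : 0 < d)
    (G : ℝ → ℝ) (hG_meas : Measurable G) (hG_nonneg : ∀ t, 0 ≤ t → 0 ≤ G t)
    (hG_bdd : ∃ C : ℝ, ∀ t, 0 ≤ t → G t ≤ C) (hG_anti : AntitoneOn G (Set.Ici 0))
    (hGd : 0 < G d)
    (I : Ω → ℝ) (hI_meas : Measurable I) (hI_nonneg : ∀ ω, 0 ≤ I ω)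
    (hI_int : Integrable I μ) (hI_var : 0 < variance I μ)
    (c : ℝ → ℝ) (hc : ∀ x, 0 < c x)
    (hGauss : ∀ x : ℝ,
      |(μ {ω | (I ω - ∫ ω', I ω' ∂μ) / Real.sqrt (variance I μ) ≤ x}).toReal -
          (∫ t in Set.Iic (x), Real.exp (-t ^ 2 / 2)) / Real.sqrt (2 * Real.pi)| ≤ c x / Real.sqrt lam)
    (Htil : Ω → ℝ) (hH_meas : Measurable Htil) (hH_nonneg : ∀ ω, 0 ≤ Htil ω)
    (hH_int : Integrable Htil μ)
    (qtil : ℝ → ℝ)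
    (hH_law : μ.map Htil = volume.withDensity fun h => ENNReal.ofReal (qtil h))
    (hindep : IndepFun I Htil μ)
    (γ : ℝ) (hγ : γ ∈ Set.Icc (0:ℝ) 1)
    (ζ : ℝ → ℝ → ℝ)
    (hζ : ∀ h R, ζ h R =
      ((h * G d / (Real.exp R - 1) - SNR⁻¹) * PG - ∫ ω, I ω ∂μ) /
        Real.sqrt (variance I μ))
    (Qm : ℝ → ℝ)
    (hQm : ∀ x, Qm x = (∫ t in Set.Iic (x), Real.exp (-t ^ 2 / 2)) / Real.sqrt (2 * Real.pi) - c x / Real.sqrt lam) :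
    sSup {R : ℝ | 0 < R ∧
        1 - ∫ ω, Set.indicator {ω' | SNR⁻¹ * (Real.exp R - 1) / G d ≤ Htil ω'}
              (fun ω' => max 0 (Qm (ζ (Htil ω') R))) ω ∂μ ≤ γ} ≤
      sSup {R : ℝ | 0 < R ∧
        (μ {ω | Real.log (1 + Htil ω * G d / (SNR⁻¹ + I ω / PG)) < R}).toReal ≤ γ} := by
  have hPG0 : 0 < PG := by linarith
  have hint_nonneg (R : ℝ) : 0 ≤ ∫ ω, Set.indicator
      {ω' | SNR⁻¹ * (Real.exp R - 1) / G d ≤ Htil ω'}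
      (fun ω' => max 0 (Qm (ζ (Htil ω') R))) ω ∂μ :=
    integral_nonneg fun ω => Set.indicator_nonneg (fun _ _ => le_max_left _ _) ω
  rcases hγ.2.eq_or_lt with rfl | hγ1
  · refine le_of_eq (congrArg sSup (Set.ext fun R => and_congr_right fun _ => ?_))
    exact iff_of_true (by linarith [hint_nonneg R]) measureReal_le_one
  refine Real.sSup_le (fun R hR => ?_) (Real.sSup_nonneg fun R hR => hR.1.le)
  obtain ⟨hR0, hR⟩ := hR
  refine le_csSup ((bddAbove_setOf_measureReal_lt_le μ _ hγ1).mono fun r hr => hr.2)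
    ⟨hR0, le_trans ?_ hR⟩
  change μ.real _ ≤ _
  set s : Set (ℝ × ℝ) := {p | p.2 ≤ (p.1 * G d / (Real.exp R - 1) - SNR⁻¹) * PG} with hs_def
  have hs : MeasurableSet s := measurableSet_le (by fun_prop) (by fun_prop)
  obtain ⟨hslice_int, hslice⟩ :=
    hindep.measureReal_preimage_prod_eq_integral hI_meas hH_meas hs
  have hcompl : {ω | Real.log (1 + Htil ω * G d / (SNR⁻¹ + I ω / PG)) < R} =
      {ω | (Htil ω, I ω) ∈ s}ᶜ := by
    ext ω
    exact not_le.symm.trans (not_congr (le_log_one_add_div_iff (inv_pos.2 hSNR) hPG0 hGd.le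
      (hH_nonneg ω) (hI_nonneg ω) hR0))
  rw [hcompl, probReal_compl_eq_one_sub (show MeasurableSet {ω | (Htil ω, I ω) ∈ s} from
    (hH_meas.prodMk hI_meas) hs), ← hslice]
  refine sub_le_sub_left ?_ 1
  refine integral_mono_of_nonneg
    (ae_of_all _ fun ω => Set.indicator_nonneg (fun _ _ => le_max_left _ _) ω) hslice_int
    (ae_of_all _ (Set.indicator_le' (fun ω _ => ?_) fun _ _ => measureReal_nonneg))
  refine max_le measureReal_nonneg ?_
  have hstd : {ω' | (I ω' - ∫ ω', I ω' ∂μ) / Real.sqrt (variance I μ) ≤ ζ (Htil ω) R} =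
      {ω' | (Htil ω, I ω') ∈ s} := by
    ext ω'
    simp only [hζ, hs_def, Set.mem_ofPred_eq]
    rw [div_le_div_iff_of_pos_right (Real.sqrt_pos.2 hI_var), sub_le_sub_iff_right]
  have hclose := hGauss (ζ (Htil ω) R)
  rw [hstd, ← measureReal_def] at hclose
  rw [hQm]
  linarith [(abs_le.1 hclose).1]
end
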